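/- Let M, N ∈ Mat_n(ℝ), and for A ∈ Mat_n(ℝ) let S(A) denote the real symmetric 2n×2n block matrix [[0, A], [Aᵀ, 0]]. Then N lies in convexHull{g M hᵀ : g, h ∈ O(n)} if and only if, for every p = 1, …, 2n, the sum of the p largest eigenvalues of S(N) is at most the sum of the p largest eigenvalues of S(M). (Equivalently, the singular values of N are weakly submajorized by those of M.) -/

import Mathlib

open Matrix

/-- The sum of the `p` largest values of `f` (with multiplicity): the supremum of all sums of
`f` over `p`-element subsets of the index set. -/
noncomputable def sumLargest {ι : Type*} [Fintype ι] (f : ι → ℝ) (p : ℕ) : ℝ :=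
  sSup {x : ℝ | ∃ s : Finset ι, s.card = p ∧ x = ∑ i ∈ s, f i}

/-- The symmetric block matrix `S(A) = [[0, A], [Aᵀ, 0]]`. -/
def symBlock {n : ℕ} (A : Matrix (Fin n) (Fin n) ℝ) :
    Matrix (Fin n ⊕ Fin n) (Fin n ⊕ Fin n) ℝ :=
  Matrix.fromBlocks 0 A Aᵀ 0

lemma isHermitian_symBlock {n : ℕ} (A : Matrix (Fin n) (Fin n) ℝ) :
    (symBlock A).IsHermitian := by
  unfold Matrix.IsHermitian symBlock
  rw [Matrix.fromBlocks_conjTranspose]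
  simp [Matrix.conjTranspose, Matrix.map_id, show ⇑(starRingEnd ℝ) = id from rfl]

lemma sum_le_sumLargest {ι : Type*} [Fintype ι] (f : ι → ℝ) {s : Finset ι} {p : ℕ}
    (hs : s.card = p) : ∑ i ∈ s, f i ≤ sumLargest f p := by
  refine le_csSup ?_ ⟨s, hs, rfl⟩
  refine ((Set.finite_range fun t : Finset ι => ∑ i ∈ t, f i).subset ?_).bddAbove
  rintro _ ⟨t, -, rfl⟩
  exact ⟨t, rfl⟩

lemma sumLargest_le {ι : Type*} [Fintype ι] {f : ι → ℝ} {p : ℕ} (hp : p ≤ Fintype.card ι) {c : ℝ}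
    (h : ∀ s : Finset ι, s.card = p → ∑ i ∈ s, f i ≤ c) : sumLargest f p ≤ c := by
  obtain ⟨s, -, hs⟩ := Finset.exists_subset_card_eq (s := (Finset.univ : Finset ι)) hp
  refine csSup_le ⟨_, s, hs, rfl⟩ ?_
  rintro _ ⟨t, ht, rfl⟩
  exact h t ht

lemma sum_doublyStochastic_le_sumLargest {ι : Type*} [Fintype ι] [DecidableEq ι]
    {D : Matrix ι ι ℝ} (hD : D ∈ doublyStochastic ℝ ι) (d : ι → ℝ) {s : Finset ι} {p : ℕ}
    (hs : s.card = p) : ∑ i ∈ s, ∑ j, D i j * d j ≤ sumLargest d p := by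
  obtain ⟨w, hw, hw1, rfl⟩ := exists_eq_sum_perm_of_mem_doublyStochastic hD
  calc ∑ i ∈ s, ∑ j, (∑ σ, w σ • σ.permMatrix ℝ) i j * d j
      = ∑ σ, w σ * ∑ i ∈ s, d (σ i) := by
        simp_rw [Matrix.sum_apply, Finset.sum_mul, Finset.mul_sum]
        rw [Finset.sum_congr rfl fun i _ => Finset.sum_comm, Finset.sum_comm]
        refine Finset.sum_congr rfl fun σ _ => ?_
        refine Finset.sum_congr rfl fun i _ => ?_
        simp [Equiv.Perm.permMatrix, PEquiv.toMatrix_apply]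
    _ ≤ ∑ σ, w σ * sumLargest d p := by
        refine Finset.sum_le_sum fun σ _ => mul_le_mul_of_nonneg_left ?_ (hw σ)
        simpa using sum_le_sumLargest d (s := s.map σ.toEmbedding) (by simpa using hs)
    _ = sumLargest d p := by rw [← Finset.sum_mul, hw1, one_mul]

/-- Ky Fan's inequality for a diagonal matrix. -/
lemma sum_conj_diagonal_le_sumLargest {ι : Type*} [Fintype ι] [DecidableEq ι]
    {Q : Matrix ι ι ℝ} (hQ : Q ∈ orthogonalGroup ι ℝ) (d : ι → ℝ) {s : Finset ι} {p : ℕ}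
    (hs : s.card = p) : ∑ i ∈ s, (Q * diagonal d * Qᵀ) i i ≤ sumLargest d p := by
  have hD : (of fun i j => Q i j ^ 2) ∈ doublyStochastic ℝ ι := by
    rw [mem_doublyStochastic_iff_sum]
    refine ⟨fun i j => sq_nonneg _, fun i => ?_, fun j => ?_⟩
    · simpa [mul_apply, sq] using congr_fun₂ ((mem_orthogonalGroup_iff ι ℝ).1 hQ) i i
    · simpa [mul_apply, sq] using congr_fun₂ ((mem_orthogonalGroup_iff' ι ℝ).1 hQ) j j
  refine le_of_eq_of_le (Finset.sum_congr rfl fun i _ => ?_)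
    (sum_doublyStochastic_le_sumLargest hD d hs)
  rw [mul_apply]
  refine Finset.sum_congr rfl fun j _ => ?_
  simp only [mul_diagonal, transpose_apply, of_apply]
  ring

lemma transpose_mem_orthogonalGroup {ι : Type*} [Fintype ι] [DecidableEq ι]
    {Q : Matrix ι ι ℝ} (hQ : Q ∈ orthogonalGroup ι ℝ) : Qᵀ ∈ orthogonalGroup ι ℝ := by
  rw [mem_orthogonalGroup_iff, transpose_transpose]
  exact (mem_orthogonalGroup_iff' ι ℝ).1 hQ

lemma transpose_mul_conj_mul {ι : Type*} [Fintype ι] [DecidableEq ι]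
    {R : Matrix ι ι ℝ} (hR : R ∈ orthogonalGroup ι ℝ) (D : Matrix ι ι ℝ) :
    Rᵀ * (R * D * Rᵀ) * R = D := by
  have h := (mem_orthogonalGroup_iff' ι ℝ).1 hR
  rw [Matrix.mul_assoc, Matrix.mul_assoc, h, Matrix.mul_one, ← Matrix.mul_assoc, h, Matrix.one_mul]

lemma exists_orthogonal_diagonalization {ι : Type*} [Fintype ι] [DecidableEq ι]
    {Z : Matrix ι ι ℝ} (hZ : Z.IsHermitian) :
    ∃ W ∈ orthogonalGroup ι ℝ, Z = W * diagonal hZ.eigenvalues * Wᵀ := by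
  refine ⟨hZ.eigenvectorUnitary, ?_, ?_⟩
  · rw [mem_orthogonalGroup_iff]
    simpa [star_eq_conjTranspose] using Unitary.coe_mul_star_self hZ.eigenvectorUnitary
  have h := hZ.spectral_theorem
  rw [Unitary.conjStarAlgAut_apply] at h
  simpa [star_eq_conjTranspose, Function.comp_def] using h

/-- Ky Fan's inequality for a symmetric matrix. -/
lemma sum_conj_le_sumLargest_eigenvalues {ι : Type*} [Fintype ι] [DecidableEq ι]
    {Z : Matrix ι ι ℝ} (hZ : Z.IsHermitian) {Q : Matrix ι ι ℝ} (hQ : Q ∈ orthogonalGroup ι ℝ)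
    {s : Finset ι} {p : ℕ} (hs : s.card = p) :
    ∑ i ∈ s, (Q * Z * Qᵀ) i i ≤ sumLargest hZ.eigenvalues p := by
  obtain ⟨W, hW, h⟩ := exists_orthogonal_diagonalization hZ
  have key := sum_conj_diagonal_le_sumLargest (mul_mem hQ hW) hZ.eigenvalues hs
  rwa [transpose_mul, show Q * W * diagonal hZ.eigenvalues * (Wᵀ * Qᵀ) =
    Q * (W * diagonal hZ.eigenvalues * Wᵀ) * Qᵀ by simp only [Matrix.mul_assoc], ← h] at key

lemma sumLargest_eigenvalues_le {ι : Type*} [Fintype ι] [DecidableEq ι]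
    {Z : Matrix ι ι ℝ} (hZ : Z.IsHermitian) {p : ℕ} (hp : p ≤ Fintype.card ι) {c : ℝ}
    (h : ∀ Q ∈ orthogonalGroup ι ℝ, ∀ s : Finset ι, s.card = p →
      ∑ i ∈ s, (Q * Z * Qᵀ) i i ≤ c) : sumLargest hZ.eigenvalues p ≤ c := by
  obtain ⟨W, hW, hWZ⟩ := exists_orthogonal_diagonalization hZ
  refine sumLargest_le hp fun s hs => le_of_eq_of_le ?_
    (h _ (transpose_mem_orthogonalGroup hW) s hs)
  have hd : Wᵀ * Z * W = diagonal hZ.eigenvalues :=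
    (congrArg (fun Y => Wᵀ * Y * W) hWZ).trans (transpose_mul_conj_mul hW _)
  simp [hd]

lemma sumLargest_eigenvalues_conj_diagonal_le {ι : Type*} [Fintype ι] [DecidableEq ι]
    {Z : Matrix ι ι ℝ} (hZ : Z.IsHermitian) {R : Matrix ι ι ℝ} (hR : R ∈ orthogonalGroup ι ℝ)
    {d : ι → ℝ} (h : Z = R * diagonal d * Rᵀ) {p : ℕ} (hp : p ≤ Fintype.card ι) :
    sumLargest hZ.eigenvalues p ≤ sumLargest d p := by
  refine sumLargest_eigenvalues_le hZ hp fun Q hQ s hs => ?_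
  have key := sum_conj_diagonal_le_sumLargest (mul_mem hQ hR) d hs
  rwa [transpose_mul, show Q * R * diagonal d * (Rᵀ * Qᵀ) = Q * (R * diagonal d * Rᵀ) * Qᵀ by
    simp only [Matrix.mul_assoc], ← h] at key

lemma sumLargest_le_sumLargest_eigenvalues {ι : Type*} [Fintype ι] [DecidableEq ι]
    {Z : Matrix ι ι ℝ} (hZ : Z.IsHermitian) {R : Matrix ι ι ℝ} (hR : R ∈ orthogonalGroup ι ℝ)
    {d : ι → ℝ} (h : Z = R * diagonal d * Rᵀ) {p : ℕ} (hp : p ≤ Fintype.card ι) :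
    sumLargest d p ≤ sumLargest hZ.eigenvalues p := by
  refine sumLargest_le hp fun s hs => ?_
  have key := sum_conj_le_sumLargest_eigenvalues hZ (transpose_mem_orthogonalGroup hR) hs
  rw [transpose_transpose, (congrArg (fun Y => Rᵀ * Y * R) h).trans (transpose_mul_conj_mul hR _)]
    at key
  simpa using key

lemma fromBlocks_mem_orthogonalGroup {n : ℕ} {g h : Matrix (Fin n) (Fin n) ℝ}
    (hg : g ∈ orthogonalGroup (Fin n) ℝ) (hh : h ∈ orthogonalGroup (Fin n) ℝ) :
    fromBlocks g 0 0 h ∈ orthogonalGroup (Fin n ⊕ Fin n) ℝ := by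
  rw [mem_orthogonalGroup_iff]
  simp [fromBlocks_transpose, fromBlocks_multiply, (mem_orthogonalGroup_iff _ ℝ).1 hg,
    (mem_orthogonalGroup_iff _ ℝ).1 hh]

lemma symBlock_mul_mul_transpose {n : ℕ} (g h A : Matrix (Fin n) (Fin n) ℝ) :
    symBlock (g * A * hᵀ) = fromBlocks g 0 0 h * symBlock A * (fromBlocks g 0 0 h)ᵀ := by
  simp [symBlock, fromBlocks_transpose, fromBlocks_multiply, Matrix.mul_assoc]

lemma sumLargest_eigenvalues_le_of_mem_convexHull {n : ℕ} {M N : Matrix (Fin n) (Fin n) ℝ}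
    (hN : N ∈ convexHull ℝ {m : Matrix (Fin n) (Fin n) ℝ |
      ∃ g ∈ orthogonalGroup (Fin n) ℝ, ∃ h ∈ orthogonalGroup (Fin n) ℝ, m = g * M * hᵀ})
    {p : ℕ} (hp : p ≤ 2 * n) :
    sumLargest (isHermitian_symBlock N).eigenvalues p ≤
      sumLargest (isHermitian_symBlock M).eigenvalues p := by
  refine sumLargest_eigenvalues_le _ (by simpa [two_mul] using hp) fun Q hQ s hs => ?_
  refine convexHull_min (t := {A | ∑ i ∈ s, (Q * symBlock A * Qᵀ) i i ≤ _}) ?_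
    (convex_halfSpace_le ⟨fun A B => ?_, fun c A => ?_⟩ _) hN
  · rintro _ ⟨g, hg, h, hh, rfl⟩
    have key := sum_conj_le_sumLargest_eigenvalues (isHermitian_symBlock M)
      (mul_mem hQ (fromBlocks_mem_orthogonalGroup hg hh)) hs
    rw [Set.mem_ofPred_eq, symBlock_mul_mul_transpose]
    simpa only [transpose_mul, Matrix.mul_assoc] using key
  · have : symBlock (A + B) = symBlock A + symBlock B := by simp [symBlock, fromBlocks_add]
    simp [this, Matrix.mul_add, Matrix.add_mul, Finset.sum_add_distrib]
  · have : symBlock (c • A) = c • symBlock A := by simp [symBlock, fromBlocks_smul]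
    simp [this, Finset.mul_sum]

/-- The singular value decomposition of a real square matrix. -/
lemma exists_singularValueDecomposition {n : ℕ} (A : Matrix (Fin n) (Fin n) ℝ) :
    ∃ U ∈ orthogonalGroup (Fin n) ℝ, ∃ V ∈ orthogonalGroup (Fin n) ℝ, ∃ m : Fin n → ℝ,
      (∀ i, 0 ≤ m i) ∧ A = U * diagonal m * Vᵀ := by
  have hpos : (Aᵀ * A).PosSemidef := by
    simpa using posSemidef_conjTranspose_mul_self A
  obtain ⟨V, hV, h⟩ := exists_orthogonal_diagonalization hpos.isHermitian
  set l := hpos.isHermitian.eigenvalues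
  have hl0 : ∀ i, 0 ≤ l i := hpos.eigenvalues_nonneg
  have hB : (A * V)ᵀ * (A * V) = diagonal l := by
    rw [transpose_mul, ← transpose_mul_conj_mul hV (diagonal l), ← h]
    simp only [Matrix.mul_assoc]
  have hBij : ∀ i j, ∑ k, (A * V) k i * (A * V) k j = if i = j then l i else 0 := fun i j => by
    have := congr_fun₂ hB i j
    rwa [mul_apply, diagonal_apply] at this
  let v : Fin n → EuclideanSpace ℝ (Fin n) := fun i =>
    WithLp.toLp 2 fun k => (A * V) k i / √(l i)
  have hv : Orthonormal ℝ (Set.domRestrict {i | l i ≠ 0} v) := by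
    rw [orthonormal_iff_ite]
    rintro ⟨i, hi⟩ ⟨j, hj⟩
    have hli : 0 < l i := lt_of_le_of_ne (hl0 i) (Ne.symm hi)
    have : inner ℝ (v i) (v j) = (∑ k, (A * V) k i * (A * V) k j) / (√(l i) * √(l j)) := by
      simp only [v, PiLp.inner_apply, Finset.sum_div]
      refine Finset.sum_congr rfl fun k _ => ?_
      simp only [RCLike.inner_apply, conj_trivial]
      ring
    simp only [Set.domRestrict_apply, this, hBij, Subtype.mk.injEq]
    split_ifs with hij
    · subst hij
      rw [Real.mul_self_sqrt hli.le, div_self hli.ne']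
    · simp
  obtain ⟨b, hb⟩ := hv.exists_orthonormalBasis_extension_of_card_eq (by simp)
  have hU : (of fun k i => b i k) ∈ orthogonalGroup (Fin n) ℝ := by
    rw [mem_orthogonalGroup_iff']
    ext i j
    have := orthonormal_iff_ite.1 b.orthonormal j i
    rw [PiLp.inner_apply] at this
    simpa [mul_apply, one_apply, eq_comm] using this
  refine ⟨_, hU, V, hV, fun i => √(l i), fun i => Real.sqrt_nonneg _, ?_⟩
  have hAV : A * V = (of fun k i => b i k) * diagonal fun i => √(l i) := by
    ext k i
    rw [mul_diagonal, of_apply]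
    by_cases hi : l i = 0
    · have h0 := hBij i i
      rw [if_pos rfl, hi, Finset.sum_eq_zero_iff_of_nonneg fun _ _ => mul_self_nonneg _] at h0
      rw [mul_self_eq_zero.1 (h0 k (Finset.mem_univ k)), hi, Real.sqrt_zero, mul_zero]
    · have : √(l i) ≠ 0 := Real.sqrt_ne_zero'.2 (lt_of_le_of_ne (hl0 i) (Ne.symm hi))
      rw [hb i hi]
      exact (div_mul_cancel₀ _ this).symm
  rw [← hAV, Matrix.mul_assoc, (mem_orthogonalGroup_iff _ ℝ).1 hV, Matrix.mul_one]

lemma exists_conj_eq_symBlock_diagonal (n : ℕ) :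
    ∃ H ∈ orthogonalGroup (Fin n ⊕ Fin n) ℝ, ∀ m : Fin n → ℝ,
      symBlock (diagonal m) = H * diagonal (Sum.elim m (-m)) * Hᵀ := by
  have h2 : (√2)⁻¹ * (√2)⁻¹ = (2⁻¹ : ℝ) := by
    rw [← mul_inv, Real.mul_self_sqrt (by norm_num)]
  let D : Matrix (Fin n) (Fin n) ℝ := diagonal fun _ => (√2)⁻¹
  refine ⟨fromBlocks D D D (-D), ?_, fun m => ?_⟩
  · rw [mem_orthogonalGroup_iff]
    simp only [D, fromBlocks_transpose, fromBlocks_multiply, diagonal_transpose, transpose_neg,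
      Matrix.mul_neg, Matrix.neg_mul, diagonal_mul_diagonal, neg_neg, h2, diagonal_add,
      add_neg_cancel, ← fromBlocks_one]
    norm_num
  · rw [← fromBlocks_diagonal]
    simp only [D, symBlock, fromBlocks_transpose, fromBlocks_multiply, diagonal_transpose,
      diagonal_mul_diagonal, diagonal_neg, diagonal_add, Matrix.mul_zero, add_zero, zero_add,
      Pi.neg_apply]
    congr 1 <;> ext i j <;> by_cases hij : i = j <;>
      simp [hij] <;> linear_combination (-2 * m j) * h2

lemma exists_symBlock_eq_conj {n : ℕ} {U V A : Matrix (Fin n) (Fin n) ℝ} {m : Fin n → ℝ}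
    (hU : U ∈ orthogonalGroup (Fin n) ℝ) (hV : V ∈ orthogonalGroup (Fin n) ℝ)
    (h : A = U * diagonal m * Vᵀ) :
    ∃ R ∈ orthogonalGroup (Fin n ⊕ Fin n) ℝ,
      symBlock A = R * diagonal (Sum.elim m (-m)) * Rᵀ := by
  obtain ⟨H, hH, hm⟩ := exists_conj_eq_symBlock_diagonal n
  refine ⟨_, mul_mem (fromBlocks_mem_orthogonalGroup hU hV) hH, ?_⟩
  rw [h, symBlock_mul_mul_transpose, hm, transpose_mul]
  simp only [Matrix.mul_assoc]

/-- Abel summation: a nonnegative antitone weight preserves nonnegativity of partial sums. -/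
lemma mul_sum_range_le_sum_mul {a d : ℕ → ℝ} (ha : Antitone a) {n : ℕ}
    (hd : ∀ k ≤ n, 0 ≤ ∑ i ∈ Finset.range k, d i) :
    a n * ∑ i ∈ Finset.range n, d i ≤ ∑ i ∈ Finset.range n, a i * d i := by
  induction n with
  | zero => simp
  | succ k ih =>
    have h1 := ih fun j hj => hd j (by omega)
    have h2 := mul_le_mul_of_nonneg_right (ha k.le_succ) (hd (k + 1) le_rfl)
    rw [Finset.sum_range_succ (fun i => a i * d i)]
    rw [Nat.succ_eq_add_one] at h2
    rw [Finset.sum_range_succ] at h2 ⊢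
    linarith

/-- Extension of a function on `Fin n` by zero. -/
def extendZero {n : ℕ} (f : Fin n → ℝ) (i : ℕ) : ℝ :=
  if h : i < n then f ⟨i, h⟩ else 0

lemma extendZero_val {n : ℕ} (f : Fin n → ℝ) (i : Fin n) : extendZero f i = f i := by
  simp [extendZero]

lemma sum_range_extendZero {n : ℕ} (f : Fin n → ℝ) {p : ℕ} (hp : p ≤ n) :
    ∑ i ∈ Finset.range p, extendZero f i = ∑ i with i.val < p, f i := by
  symm
  refine Finset.sum_bij (fun i _ => i.val) (by simp) (fun i _ j _ => Fin.ext) (fun j hj => ?_)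
    fun i _ => (extendZero_val f i).symm
  rw [Finset.mem_range] at hj
  exact ⟨⟨j, by omega⟩, by simpa using hj, rfl⟩

lemma antitone_extendZero {n : ℕ} {f : Fin n → ℝ} (hf : Antitone f) (h0 : ∀ i, 0 ≤ f i) :
    Antitone (extendZero f) := by
  intro i j hij
  unfold extendZero
  split_ifs with hj hi
  · exact hf hij
  · omega
  · exact h0 _
  · rfl

lemma sum_mul_le_sum_mul_of_sum_le {n : ℕ} {a y z : Fin n → ℝ} (ha : Antitone a)
    (ha0 : ∀ i, 0 ≤ a i)
    (h : ∀ p ≤ n, ∑ i with i.val < p, y i ≤ ∑ i with i.val < p, z i) :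
    ∑ i, a i * y i ≤ ∑ i, a i * z i := by
  have key := mul_sum_range_le_sum_mul (antitone_extendZero ha ha0) (n := n)
    (d := extendZero fun i => z i - y i) fun k hk => by
      rw [sum_range_extendZero _ hk, Finset.sum_sub_distrib]
      exact sub_nonneg.2 (h k hk)
  rw [← Fin.sum_univ_eq_sum_range (fun i => extendZero a i * extendZero _ i) n] at key
  simp only [extendZero_val, mul_sub, Finset.sum_sub_distrib] at key
  simpa [extendZero] using key

lemma card_filter_val_lt {n p : ℕ} (hp : p ≤ n) :
    (Finset.univ.filter fun i : Fin n => i.val < p).card = p := by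
  rw [Fin.card_filter_val_lt, min_eq_right hp]

lemma sum_le_sum_filter_val_lt {n : ℕ} {a : Fin n → ℝ} (ha : Antitone a) (ha0 : ∀ i, 0 ≤ a i)
    {p : ℕ} (hp : p ≤ n) {L : Finset (Fin n)} (hL : L.card ≤ p) :
    ∑ i ∈ L, a i ≤ ∑ i with i.val < p, a i := by
  have hmono := antitone_extendZero ha ha0
  set t := extendZero a p with ht
  have ht0 : 0 ≤ t := by
    rw [ht, extendZero]
    split_ifs
    exacts [ha0 _, le_rfl]
  have key : ∑ i ∈ L, (a i - t) ≤ ∑ i with i.val < p, (a i - t) := by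
    rw [← Finset.sum_filter_add_sum_filter_not L (fun i => i.val < p)]
    have h1 : ∑ i ∈ L with ¬ i.val < p, (a i - t) ≤ 0 := by
      refine Finset.sum_nonpos fun i hi => sub_nonpos.2 ?_
      rw [← extendZero_val a i]
      exact hmono (not_lt.1 (Finset.mem_filter.1 hi).2)
    have h2 : ∑ i ∈ L with i.val < p, (a i - t) ≤ ∑ i with i.val < p, (a i - t) := by
      refine Finset.sum_le_sum_of_subset_of_nonneg
        (Finset.filter_subset_filter _ (Finset.subset_univ L)) fun i hi _ => sub_nonneg.2 ?_
      rw [← extendZero_val a i]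
      exact hmono (Finset.mem_filter.1 hi).2.le
    linarith
  simp only [Finset.sum_sub_distrib, Finset.sum_const, card_filter_val_lt hp, nsmul_eq_mul] at key
  have : (L.card : ℝ) * t ≤ p * t := mul_le_mul_of_nonneg_right (by exact_mod_cast hL) ht0
  linarith

lemma exists_perm_antitone_comp {n : ℕ} (f : Fin n → ℝ) :
    ∃ σ : Equiv.Perm (Fin n), Antitone (f ∘ σ) :=
  ⟨Tuple.sort (-f), fun i j hij => by simpa using Tuple.monotone_sort (-f) hij⟩

lemma sumLargest_sumElim_neg_le {n : ℕ} {m : Fin n → ℝ} (hm : ∀ i, 0 ≤ m i)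
    {σ : Equiv.Perm (Fin n)} (hσ : Antitone (m ∘ σ)) {p : ℕ} (hp : p ≤ n) :
    sumLargest (Sum.elim m (-m)) p ≤ ∑ i with i.val < p, m (σ i) := by
  refine sumLargest_le (by simp; omega) fun s hs => ?_
  calc ∑ i ∈ s, Sum.elim m (-m) i
      = ∑ i ∈ s.toLeft, m i + ∑ i ∈ s.toRight, -m i := by
        conv_lhs => rw [← Finset.toLeft_disjSum_toRight (u := s), Finset.sum_disjSum]
        simp
    _ ≤ ∑ i ∈ s.toLeft, m i :=
        add_le_of_nonpos_right (Finset.sum_nonpos fun i _ => neg_nonpos.2 (hm i))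
    _ = ∑ i ∈ s.toLeft.map σ.symm.toEmbedding, (m ∘ σ) i := by simp
    _ ≤ ∑ i with i.val < p, m (σ i) :=
        sum_le_sum_filter_val_lt hσ (fun i => hm _) hp
          (by rw [Finset.card_map, ← hs]; exact Finset.card_toLeft_le)

/-- A nonnegative vector that is weakly submajorized by another one is a convex combination of
signed permutations of it. -/
lemma mem_convexHull_signed_perm {n : ℕ} {y m : Fin n → ℝ} (hy : ∀ i, 0 ≤ y i)
    (hm : ∀ i, 0 ≤ m i)
    (h : ∀ p ≤ n, sumLargest (Sum.elim y (-y)) p ≤ sumLargest (Sum.elim m (-m)) p) :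
    y ∈ convexHull ℝ (Set.range fun x : (Fin n → ℤˣ) × Equiv.Perm (Fin n) =>
      fun i => ((x.1 i : ℤ) : ℝ) * m (x.2 i)) := by
  by_contra hcon
  obtain ⟨f, u, hu, huy⟩ := geometric_hahn_banach_closed_point (convex_convexHull ℝ _)
    ((Set.finite_range _).isClosed_convexHull ℝ) hcon
  let c : Fin n → ℝ := fun i => f (Pi.single i 1)
  have hf : ∀ x : Fin n → ℝ, f x = ∑ i, c i * x i := fun x => by
    conv_lhs => rw [pi_eq_sum_univ' x, map_sum]
    refine Finset.sum_congr rfl fun i _ => ?_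
    rw [map_smul, smul_eq_mul, mul_comm]
  obtain ⟨τ, hτ⟩ := exists_perm_antitone_comp fun i => |c i|
  obtain ⟨ρ, hρ⟩ := exists_perm_antitone_comp m
  let ε : Fin n → ℤˣ := fun i => if 0 ≤ c i then 1 else -1
  have hε : ∀ i, c i * ((ε i : ℤ) : ℝ) = |c i| := fun i => by
    by_cases hi : 0 ≤ c i
    · simp [ε, hi, abs_of_nonneg hi]
    · simp [ε, hi, abs_of_neg (not_le.1 hi)]
  have hlt := hu _ (subset_convexHull ℝ _ ⟨(ε, τ.symm.trans ρ), rfl⟩)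
  refine absurd (huy.trans_le ?_) hlt.not_gt
  calc f y = ∑ i, c i * y i := hf y
    _ ≤ ∑ i, |c i| * y i :=
        Finset.sum_le_sum fun i _ => mul_le_mul_of_nonneg_right (le_abs_self _) (hy i)
    _ = ∑ i, |c (τ i)| * y (τ i) := (Equiv.sum_comp τ fun i => |c i| * y i).symm
    _ ≤ ∑ i, |c (τ i)| * m (ρ i) := by
        refine sum_mul_le_sum_mul_of_sum_le hτ (fun i => abs_nonneg _) fun p hp => ?_
        refine le_trans ?_ ((h p hp).trans (sumLargest_sumElim_neg_le hm hρ hp))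
        simpa using sum_le_sumLargest (Sum.elim y (-y)) (p := p)
          (s := ((Finset.univ.filter fun i : Fin n => i.val < p).map τ.toEmbedding).map
            Function.Embedding.inl) (by rw [Finset.card_map, Finset.card_map, card_filter_val_lt hp])
    _ = ∑ i, |c i| * m (ρ (τ.symm i)) := by
        rw [← Equiv.sum_comp τ fun i => |c i| * m (ρ (τ.symm i))]
        simp
    _ = _ := by
        rw [hf]
        refine Finset.sum_congr rfl fun i _ => ?_
        rw [← mul_assoc, hε]
        rfl

lemma exists_conj_diagonal_eq_signed_perm {n : ℕ} (ε : Fin n → ℤˣ) (σ : Equiv.Perm (Fin n))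
    (m : Fin n → ℝ) :
    ∃ g ∈ orthogonalGroup (Fin n) ℝ, ∃ h ∈ orthogonalGroup (Fin n) ℝ,
      diagonal (fun i => ((ε i : ℤ) : ℝ) * m (σ i)) = g * diagonal m * hᵀ := by
  let E : (Fin n → ℝ) → Matrix (Fin n) (Fin n) ℝ := fun e =>
    of fun i j => if σ i = j then e i else 0
  have hE : ∀ d e m' : Fin n → ℝ, E d * diagonal m' * (E e)ᵀ =
      diagonal fun i => d i * m' (σ i) * e i := fun d e m' => by
    ext i j
    rw [mul_apply]
    simp only [E, mul_diagonal, transpose_apply, of_apply, diagonal_apply]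
    by_cases hij : i = j <;> simp [hij]
  have hmem : ∀ e : Fin n → ℝ, (∀ i, e i * e i = 1) → E e ∈ orthogonalGroup (Fin n) ℝ :=
    fun e he => by
      rw [mem_orthogonalGroup_iff]
      simpa [he] using hE e e 1
  refine ⟨E fun i => ((ε i : ℤ) : ℝ), hmem _ fun i => ?_, E 1, hmem _ fun i => by simp, ?_⟩
  · exact_mod_cast Int.units_coe_mul_self (ε i)
  · rw [hE]
    simp

lemma mem_convexHull_of_sumLargest_eigenvalues_le {n : ℕ} {M N : Matrix (Fin n) (Fin n) ℝ}
    (hMN : ∀ p ≤ n, sumLargest (isHermitian_symBlock N).eigenvalues p ≤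
      sumLargest (isHermitian_symBlock M).eigenvalues p) :
    N ∈ convexHull ℝ {m : Matrix (Fin n) (Fin n) ℝ |
      ∃ g ∈ orthogonalGroup (Fin n) ℝ, ∃ h ∈ orthogonalGroup (Fin n) ℝ, m = g * M * hᵀ} := by
  obtain ⟨U, hU, V, hV, m, hm, hM⟩ := exists_singularValueDecomposition M
  obtain ⟨U', hU', V', hV', y, hy, hN⟩ := exists_singularValueDecomposition N
  obtain ⟨R, hR, hRM⟩ := exists_symBlock_eq_conj hU hV hM
  obtain ⟨R', hR', hRN⟩ := exists_symBlock_eq_conj hU' hV' hN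
  have hmem := mem_convexHull_signed_perm hy hm fun p hp => by
    have hp' : p ≤ Fintype.card (Fin n ⊕ Fin n) := by simp; omega
    exact (sumLargest_le_sumLargest_eigenvalues (isHermitian_symBlock N) hR' hRN hp').trans
      ((hMN p hp).trans
        (sumLargest_eigenvalues_conj_diagonal_le (isHermitian_symBlock M) hR hRM hp'))
  have hMm : diagonal m = Uᵀ * M * V := by
    have hV1 := (mem_orthogonalGroup_iff' _ ℝ).1 hV
    rw [hM, ← Matrix.mul_assoc, ← Matrix.mul_assoc, (mem_orthogonalGroup_iff' _ ℝ).1 hU,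
      Matrix.one_mul, Matrix.mul_assoc, hV1, Matrix.mul_one]
  let F : (Fin n → ℝ) →ₗ[ℝ] Matrix (Fin n) (Fin n) ℝ :=
    LinearMap.mulRight ℝ V'ᵀ ∘ₗ LinearMap.mulLeft ℝ U' ∘ₗ diagonalLinearMap (Fin n) ℝ ℝ
  have hF : ∀ x, F x = U' * diagonal x * V'ᵀ := fun x => rfl
  rw [hN, ← hF]
  have := Set.mem_image_of_mem F hmem
  rw [LinearMap.image_convexHull] at this
  refine convexHull_mono ?_ this
  rintro _ ⟨_, ⟨⟨ε, σ⟩, rfl⟩, rfl⟩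
  obtain ⟨g, hg, h, hh, hgh⟩ := exists_conj_diagonal_eq_signed_perm ε σ m
  refine ⟨U' * g * Uᵀ, mul_mem (mul_mem hU' hg) (transpose_mem_orthogonalGroup hU),
    V' * h * Vᵀ, mul_mem (mul_mem hV' hh) (transpose_mem_orthogonalGroup hV), ?_⟩
  rw [hF, hgh, hMm]
  simp only [transpose_mul, transpose_transpose, Matrix.mul_assoc]

/-- Let `M`, `N` be real `n × n` matrices, and `S(A) = [[0, A], [Aᵀ, 0]]`. Then
`N` lies in the convex hull of `{g M hᵀ : g, h ∈ O(n)}` iff for every `p = 1, …, 2n` the sum of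
the `p` largest eigenvalues of `S(N)` is at most that of `S(M)` (equivalently, the singular
values of `N` are weakly submajorized by those of `M`). -/
theorem mem_fan_orbitope_iff
    {n : ℕ} (M N : Matrix (Fin n) (Fin n) ℝ) :
    N ∈ convexHull ℝ {m : Matrix (Fin n) (Fin n) ℝ |
        ∃ g ∈ Matrix.orthogonalGroup (Fin n) ℝ,
          ∃ h ∈ Matrix.orthogonalGroup (Fin n) ℝ, m = g * M * hᵀ} ↔
      ∀ p : ℕ, 1 ≤ p → p ≤ 2 * n →
        sumLargest (isHermitian_symBlock N).eigenvalues p ≤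
          sumLargest (isHermitian_symBlock M).eigenvalues p := by
  refine ⟨fun hN p _ hp => sumLargest_eigenvalues_le_of_mem_convexHull hN hp, fun h => ?_⟩
  refine mem_convexHull_of_sumLargest_eigenvalues_le fun p hp => ?_
  rcases Nat.eq_zero_or_pos p with rfl | hp0
  · refine sumLargest_le (Nat.zero_le _) fun s hs => ?_
    simpa [Finset.card_eq_zero.1 hs] using
      sum_le_sumLargest (isHermitian_symBlock M).eigenvalues (s := ∅) Finset.card_empty
  · exact h p hp0 (by omega)
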